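/- Let E be a finite-dimensional real inner product space, E₀ ⊆ E a subspace, Q a symmetric bilinear form on E₀, τ > 0, and t ↦ R_t a continuous family of self-adjoint operators on E. Then the Morse index of the index form I on Ω([0,τ],E) is equal to the maximal number of linearly independent elements of Ω([0,τ],E) that are C² and are eigenfunctions of the differential operator J = d²/dt² + R_t for positive eigenvalues, i.e. C² curves u ∈ Ω([0,τ],E) satisfying u''(t) + R_t(u(t)) = λ u(t) on [0,τ] for some λ > 0. -/

import Mathlib

open scoped RealInnerProductSpace

variable {E : Type*} [NormedAddCommGroup E] [InnerProductSpace ℝ E]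

/-- `f : ℝ → E` is continuous on `[a,b]` and piecewise `C^n` there, i.e. there is a
finite partition `a = s₀ < s₁ < ⋯ < s_k = b` such that `f` is `C^n` on each closed
subinterval `[sᵢ, sᵢ₊₁]` (derivatives being taken one-sidedly at the endpoints). -/
def PiecewiseContDiffOn (n : ℕ) (f : ℝ → E) (a b : ℝ) : Prop :=
  ContinuousOn f (Set.Icc a b) ∧
  ∃ (k : ℕ) (s : Fin (k + 1) → ℝ), StrictMono s ∧ s 0 = a ∧ s (Fin.last k) = b ∧
    ∀ i : Fin k, ContDiffOn ℝ (n : ℕ∞) f (Set.Icc (s i.castSucc) (s i.succ))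

/-- Membership in the space `Ω([0,τ],E)` of continuous piecewise `C²` curves
`v : [0,τ] → E` with `v 0 ∈ E₀`, `⟪v' 0, w⟫ = -Q (v 0) w` for all `w ∈ E₀`, and `v τ = 0`. -/
def InOmega (E₀ : Submodule ℝ E) (Q : E →ₗ[ℝ] E →ₗ[ℝ] ℝ) (τ : ℝ) (v : ℝ → E) : Prop :=
  PiecewiseContDiffOn 2 v 0 τ ∧ v 0 ∈ E₀ ∧
  (∀ w ∈ E₀, ⟪derivWithin v (Set.Icc 0 τ) 0, w⟫ = -(Q (v 0) w)) ∧
  v τ = 0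

/-- The index form `I(v) = -Q(v 0, v 0) + ∫₀^τ (⟪v', v'⟫ - ⟪R_t (v t), v t⟫) dt`. -/
noncomputable def indexForm (R : ℝ → E →L[ℝ] E) (Q : E →ₗ[ℝ] E →ₗ[ℝ] ℝ) (τ : ℝ)
    (v : ℝ → E) : ℝ :=
  -(Q (v 0) (v 0)) + ∫ t in (0:ℝ)..τ,
    (⟪derivWithin v (Set.Icc 0 τ) t, derivWithin v (Set.Icc 0 τ) t⟫ - ⟪R t (v t), v t⟫)

/-- A `C²` curve `u : [0,a] → E` with `u'' + R_t u = 0` on `[0,a]`, `u 0 ∈ E₀`,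
`⟪u' 0, w⟫ = -Q (u 0) w` for all `w ∈ E₀`, and `u a = 0`. -/
def IsFocalSolution (R : ℝ → E →L[ℝ] E) (E₀ : Submodule ℝ E) (Q : E →ₗ[ℝ] E →ₗ[ℝ] ℝ)
    (a : ℝ) (u : ℝ → E) : Prop :=
  ContDiffOn ℝ 2 u (Set.Icc 0 a) ∧
  (∀ t ∈ Set.Icc 0 a,
    derivWithin (derivWithin u (Set.Icc 0 a)) (Set.Icc 0 a) t + R t (u t) = 0) ∧
  u 0 ∈ E₀ ∧
  (∀ w ∈ E₀, ⟪derivWithin u (Set.Icc 0 a) 0, w⟫ = -(Q (u 0) w)) ∧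
  u a = 0

/-- `a ∈ (0,τ]` is a focal point for `J = d²/dt² + R_t` and boundary condition `(E₀, Q)`
if there is a nontrivial solution on `[0,a]`. -/
def IsFocalPoint (R : ℝ → E →L[ℝ] E) (E₀ : Submodule ℝ E) (Q : E →ₗ[ℝ] E →ₗ[ℝ] ℝ)
    (τ a : ℝ) : Prop :=
  a ∈ Set.Ioc 0 τ ∧
  ∃ u : ℝ → E, IsFocalSolution R E₀ Q a u ∧ ∃ t ∈ Set.Icc 0 a, u t ≠ 0

/-- The multiplicity of a focal point: the maximal number of focal solutions on `[0,a]`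
that are linearly independent as curves on `[0,a]`. -/
noncomputable def focalMultiplicity (R : ℝ → E →L[ℝ] E) (E₀ : Submodule ℝ E)
    (Q : E →ₗ[ℝ] E →ₗ[ℝ] ℝ) (a : ℝ) : ℕ :=
  sSup {n : ℕ | ∃ u : Fin n → ℝ → E,
    (∀ i, IsFocalSolution R E₀ Q a (u i)) ∧
    ∀ c : Fin n → ℝ, (∀ t ∈ Set.Icc 0 a, (∑ i, c i • u i t) = 0) → c = 0}

/-- The set of `n` such that there are `n` elements of `Ω([0,τ],E)`, linearly independent
as curves on `[0,τ]`, on (the span of) which the index form is negative.  The Morse index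
of the index form is the supremum of this set. -/
def MorseIndexSet (R : ℝ → E →L[ℝ] E) (E₀ : Submodule ℝ E) (Q : E →ₗ[ℝ] E →ₗ[ℝ] ℝ)
    (τ : ℝ) : Set ℕ :=
  {n | ∃ v : Fin n → ℝ → E,
    (∀ i, InOmega E₀ Q τ (v i)) ∧
    (∀ c : Fin n → ℝ, (∀ t ∈ Set.Icc 0 τ, (∑ i, c i • v i t) = 0) → c = 0) ∧
    (∀ c : Fin n → ℝ, c ≠ 0 → indexForm R Q τ (fun t => ∑ i, c i • v i t) < 0)}

/-- `J = d²/dt² + R_t` is disconjugate on a set `s ⊆ ℝ`: no nontrivial `C²` solution of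
`u'' + R_t u = 0` on `s` vanishes at two distinct points of `s`. -/
def DisconjugateOn (R : ℝ → E →L[ℝ] E) (s : Set ℝ) : Prop :=
  ∀ u : ℝ → E, ContDiffOn ℝ 2 u s →
    (∀ t ∈ s, derivWithin (derivWithin u s) s t + R t (u t) = 0) →
    ∀ s₁ ∈ s, ∀ s₂ ∈ s, s₁ ≠ s₂ → u s₁ = 0 → u s₂ = 0 → ∀ t ∈ s, u t = 0

/-- `a < b` are mutually conjugate if there is a not-identically-zero `C²` solution of
`v'' + R_t v = 0` on `[a,b]` with `v a = v b = 0`. -/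
def MutuallyConjugate (R : ℝ → E →L[ℝ] E) (a b : ℝ) : Prop :=
  a < b ∧ ∃ v : ℝ → E, ContDiffOn ℝ 2 v (Set.Icc a b) ∧
    (∀ t ∈ Set.Icc a b,
      derivWithin (derivWithin v (Set.Icc a b)) (Set.Icc a b) t + R t (v t) = 0) ∧
    v a = 0 ∧ v b = 0 ∧ ∃ t ∈ Set.Icc a b, v t ≠ 0

/-- `u` is a `C²` element of `Ω([0,τ],E)` which is an eigenfunction of
`J = d²/dt² + R_t` for a positive eigenvalue, i.e. `u'' + R_t u = λ u` on `[0,τ]`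
for some `λ > 0`. -/
def IsPositiveEigenfunction (R : ℝ → E →L[ℝ] E) (E₀ : Submodule ℝ E)
    (Q : E →ₗ[ℝ] E →ₗ[ℝ] ℝ) (τ : ℝ) (u : ℝ → E) : Prop :=
  InOmega E₀ Q τ u ∧ ContDiffOn ℝ 2 u (Set.Icc 0 τ) ∧
  ∃ lam : ℝ, 0 < lam ∧ ∀ t ∈ Set.Icc 0 τ,
    derivWithin (derivWithin u (Set.Icc 0 τ)) (Set.Icc 0 τ) t + R t (u t) = lam • u t

section abstr
open Filter Topology MeasureTheory
variable {H F : Type*} [NormedAddCommGroup H] [InnerProductSpace ℝ H]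
  [NormedAddCommGroup F] [NormedSpace ℝ F]

noncomputable def PF (W : H →L[ℝ] F) (k s : F →L[ℝ] F →L[ℝ] ℝ) (l : ℝ) : H →L[ℝ] H →L[ℝ] ℝ :=
  (LinearMap.mkContinuous₂ (innerₗ H) 1 (fun x y => by
    simpa using norm_inner_le_norm (𝕜 := ℝ) x y)) - k.bilinearComp W W + l • s.bilinearComp W W

lemma PF_apply (W : H →L[ℝ] F) (k s : F →L[ℝ] F →L[ℝ] ℝ) (l : ℝ) (x y : H) :
    PF W k s l x y = ⟪x, y⟫ - k (W x) (W y) + l * s (W x) (W y) := by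
  simp [PF]

lemma bil_tendsto {G : Type*} [NormedAddCommGroup G] [NormedSpace ℝ G] (k : G →L[ℝ] G →L[ℝ] ℝ)
    {u : ℕ → G} {y : G} (h : Tendsto u atTop (𝓝 y)) :
    Tendsto (fun n => k (u n) (u n)) atTop (𝓝 (k y y)) := by
  have : Continuous fun z => k z z := by fun_prop
  exact (this.tendsto y).comp h

def SeqCpt (W : H →L[ℝ] F) : Prop := ∀ x : ℕ → H, (∀ n, ‖x n‖ ≤ 1) →
  ∃ φ : ℕ → ℕ, StrictMono φ ∧ ∃ y, Tendsto (fun n => W (x (φ n))) atTop (𝓝 y)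

lemma PF_symm (W : H →L[ℝ] F) (k s : F →L[ℝ] F →L[ℝ] ℝ) (hk : ∀ x y, k x y = k y x)
    (hs : ∀ x y, s x y = s y x) (l : ℝ) (x y : H) :
    PF W k s l x y = PF W k s l y x := by
  rw [PF_apply, PF_apply, hk, hs, real_inner_comm]

lemma PF_norm (W : H →L[ℝ] F) (k s : F →L[ℝ] F →L[ℝ] ℝ) (l : ℝ) (M : Submodule ℝ H) (x : H)
    (hxM : x ∈ M) (hx : PF W k s l x x < 0) : ∃ y ∈ M, ‖y‖ = 1 ∧ PF W k s l y y < 0 := by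
  have hx0 : x ≠ 0 := by rintro rfl; simp at hx
  have hn : 0 < ‖x‖ := norm_pos_iff.2 hx0
  refine ⟨‖x‖⁻¹ • x, M.smul_mem _ hxM, ?_, ?_⟩
  · rw [norm_smul]; simp [hn.ne']
  · simp only [map_smul, smul_apply, smul_eq_mul]
    have : 0 < ‖x‖⁻¹ := inv_pos.2 hn
    exact mul_neg_of_pos_of_neg this (mul_neg_of_pos_of_neg this hx)

lemma exists_large (W : H →L[ℝ] F) (hW : SeqCpt W) (k s : F →L[ℝ] F →L[ℝ] ℝ)
    (hs : ∀ x, x ≠ 0 → 0 < s x x) : ∃ l : ℝ, ∀ x, 0 ≤ PF W k s l x x := by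
  by_contra! hcon
  have h1 : ∀ n : ℕ, ∃ y, ‖y‖ = 1 ∧ PF W k s (n : ℝ) y y < 0 := by
    intro n
    obtain ⟨x, hx⟩ := hcon n
    obtain ⟨y, -, hy⟩ := PF_norm W k s n ⊤ x trivial hx
    exact ⟨y, hy⟩
  choose x hx1 hx2 using h1
  obtain ⟨φ, hφ, y, hy⟩ := hW x (fun n => (hx1 n).le)
  have hs0 : ∀ z, 0 ≤ s z z := fun z => by
    by_cases h : z = 0
    · simp [h]
    · exact (hs z h).le
  have hk : Tendsto (fun n => k (W (x (φ n))) (W (x (φ n)))) atTop (𝓝 (k y y)) :=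
    bil_tendsto k hy
  have hss : Tendsto (fun n => s (W (x (φ n))) (W (x (φ n)))) atTop (𝓝 (s y y)) :=
    bil_tendsto s hy
  have hge : ∀ n : ℕ, 1 + (n : ℝ) * s (W (x (φ n))) (W (x (φ n))) ≤ k (W (x (φ n))) (W (x (φ n))) := by
    intro n
    have := hx2 (φ n)
    rw [PF_apply, real_inner_self_eq_norm_sq, hx1] at this
    have h2 : (n : ℝ) ≤ φ n := by exact_mod_cast hφ.id_le n
    nlinarith [mul_le_mul_of_nonneg_right h2 (hs0 (W (x (φ n))))]
  have hy0 : y = 0 := by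
    by_contra hne
    have hpos := hs y hne
    have : Tendsto (fun n : ℕ => (n : ℝ) * s (W (x (φ n))) (W (x (φ n)))) atTop atTop :=
      tendsto_natCast_atTop_atTop.atTop_mul_pos hpos hss
    have h3 : Tendsto (fun n => k (W (x (φ n))) (W (x (φ n)))) atTop atTop :=
      tendsto_atTop_mono (fun n => by linarith [hge n]) this
    exact not_tendsto_nhds_of_tendsto_atTop h3 _ hk
  have : 1 ≤ k y y := ge_of_tendsto' hk (fun n => by
    have := hge n
    have h2 : 0 ≤ (n : ℝ) * s (W (x (φ n))) (W (x (φ n))) := mul_nonneg (Nat.cast_nonneg _) (hs0 _)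
    linarith)
  rw [hy0] at this
  simp at this
  linarith

lemma psd_zero (P : H →L[ℝ] H →L[ℝ] ℝ) (hP : ∀ x y, P x y = P y x) (M : Submodule ℝ H)
    (hM : ∀ x ∈ M, 0 ≤ P x x) (x : H) (hx : x ∈ M) (h0 : P x x = 0) (y : H) (hy : y ∈ M) :
    P x y = 0 := by
  have hc := hM y hy
  have key : ∀ t : ℝ, 0 ≤ 2 * t * P x y + t ^ 2 * P y y := by
    intro t
    have := hM (x + t • y) (M.add_mem hx (M.smul_mem t hy))
    simp only [map_add, map_smul, add_apply, smul_apply,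
      smul_eq_mul, h0, hP y x] at this
    linarith
  have := key (-(P x y) / (P y y + 1))
  have hc1 : 0 < P y y + 1 := by linarith
  have e : 2 * (-(P x y) / (P y y + 1)) * P x y + (-(P x y) / (P y y + 1)) ^ 2 * P y y
    = -((P x y) ^ 2 * (P y y + 2)) / (P y y + 1) ^ 2 := by
    field_simp; ring
  rw [e] at this
  have h3 : 0 ≤ -((P x y) ^ 2 * (P y y + 2)) := by
    by_contra! hneg
    exact absurd this (not_le.2 (div_neg_of_neg_of_pos hneg (by positivity)))
  have h4 : P x y ^ 2 = 0 := by nlinarith [sq_nonneg (P x y)]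
  exact pow_eq_zero_iff (two_ne_zero) |>.1 h4

lemma exists_eig [CompleteSpace H] (W : H →L[ℝ] F) (hW : SeqCpt W) (k s : F →L[ℝ] F →L[ℝ] ℝ)
    (hk : ∀ x y, k x y = k y x) (hs : ∀ x y, s x y = s y x)
    (hspos : ∀ x, x ≠ 0 → 0 < s x x) (M : Submodule ℝ H) (hMc : IsClosed (M : Set H))
    (x0 : H) (hx0 : x0 ∈ M) (hneg : PF W k s 0 x0 x0 < 0) :
    ∃ l : ℝ, 0 < l ∧ ∃ x ∈ M, x ≠ 0 ∧ ∀ y ∈ M, PF W k s l x y = 0 := by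
  have hs0 : ∀ z, 0 ≤ s z z := fun z => by
    by_cases h : z = 0
    · simp [h]
    · exact (hspos z h).le
  set A : Set ℝ := {l | ∀ x ∈ M, 0 ≤ PF W k s l x x} with hA
  have hAne : A.Nonempty := by
    obtain ⟨l, hl⟩ := exists_large W hW k s hspos
    exact ⟨l, fun x _ => hl x⟩
  have hApos : ∀ l ∈ A, 0 < l * s (W x0) (W x0) := by
    intro l hl
    have := hl x0 hx0
    rw [PF_apply] at this hneg
    linarith
  have hApos' : ∀ l ∈ A, 0 < l := by
    intro l hl
    by_contra! h
    have := hApos l hl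
    nlinarith [hs0 (W x0)]
  have hAbdd : BddBelow A := ⟨0, fun l hl => (hApos' l hl).le⟩
  have hAcl : IsClosed A := by
    have : A = ⋂ x ∈ M, {l | 0 ≤ PF W k s l x x} := by ext; simp [hA]
    rw [this]
    refine isClosed_biInter fun x _ => ?_
    simp only [PF_apply]
    exact isClosed_le continuous_const (by fun_prop)
  set L := sInf A with hL
  have hLA : L ∈ A := hAcl.csInf_mem hAne hAbdd
  refine ⟨L, hApos' L hLA, ?_⟩
  have h1 : ∀ n : ℕ, ∃ y ∈ M, ‖y‖ = 1 ∧ PF W k s (L - 1 / ((n : ℝ) + 1)) y y < 0 := by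
    intro n
    have hn : (0:ℝ) < 1 / ((n : ℝ) + 1) := by positivity
    have : L - 1 / ((n : ℝ) + 1) ∉ A := fun h => by
      have := csInf_le hAbdd h
      linarith
    simp only [hA, Set.mem_ofPred_eq, not_forall, not_le] at this
    obtain ⟨x, hxM, hx⟩ := this
    exact PF_norm W k s _ M x hxM hx
  choose x hxM hx1 hx2 using h1
  obtain ⟨φ, hφ, y, hy⟩ := hW x (fun n => (hx1 n).le)
  have hss : Tendsto (fun n => s (W (x (φ n))) (W (x (φ n)))) atTop (𝓝 (s y y)) :=
    bil_tendsto s hy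
  set P := PF W k s L with hP
  have hp0 : Tendsto (fun n => P (x (φ n)) (x (φ n))) atTop (𝓝 0) := by
    have h2 : Tendsto (fun n : ℕ => 1 / (((φ n : ℕ) : ℝ) + 1) * s (W (x (φ n))) (W (x (φ n)))) atTop
        (𝓝 (0 * s y y)) :=
      ((tendsto_one_div_add_atTop_nhds_zero_nat (𝕜 := ℝ)).comp hφ.tendsto_atTop).mul hss
    rw [zero_mul] at h2
    refine squeeze_zero (fun n => hLA _ (hxM _)) (fun n => ?_) h2
    have := hx2 (φ n)
    rw [PF_apply] at this
    rw [hP, PF_apply]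
    linarith
  -- Cauchy
  have hcau : CauchySeq (fun n => x (φ n)) := by
    set C := ‖k‖ + |L| * ‖s‖ with hC
    have hC0 : 0 ≤ C := by positivity
    have key : ∀ n m, ‖x (φ n) - x (φ m)‖ ^ 2 ≤ 2 * P (x (φ n)) (x (φ n)) + 2 * P (x (φ m)) (x (φ m))
        + C * ‖W (x (φ n)) - W (x (φ m))‖ ^ 2 := by
      intro n m
      have hpl := hLA (x (φ n) + x (φ m)) (M.add_mem (hxM _) (hxM _))
      rw [← hP] at hpl
      have e1 : P (x (φ n) + x (φ m)) (x (φ n) + x (φ m)) + P (x (φ n) - x (φ m)) (x (φ n) - x (φ m))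
        = 2 * P (x (φ n)) (x (φ n)) + 2 * P (x (φ m)) (x (φ m)) := by
        simp only [map_add, map_sub, add_apply, sub_apply]
        ring
      have e2 : P (x (φ n) - x (φ m)) (x (φ n) - x (φ m)) =
        ‖x (φ n) - x (φ m)‖ ^ 2 - k (W (x (φ n)) - W (x (φ m))) (W (x (φ n)) - W (x (φ m)))
         + L * s (W (x (φ n)) - W (x (φ m))) (W (x (φ n)) - W (x (φ m))) := by
        rw [hP, PF_apply, real_inner_self_eq_norm_sq, map_sub]
      set z := W (x (φ n)) - W (x (φ m))
      have e3 : k z z ≤ ‖k‖ * ‖z‖ ^ 2 := by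
        have := k.le_opNorm₂ z z
        rw [Real.norm_eq_abs] at this
        nlinarith [le_abs_self (k z z)]
      have e4 : -(|L| * (‖s‖ * ‖z‖ ^ 2)) ≤ L * s z z := by
        have := s.le_opNorm₂ z z
        have h5 : |L * s z z| ≤ |L| * (‖s‖ * ‖z‖ ^ 2) := by
          rw [abs_mul]
          refine mul_le_mul_of_nonneg_left ?_ (abs_nonneg _)
          rw [Real.norm_eq_abs] at this
          linarith [this, mul_assoc ‖s‖ ‖z‖ ‖z‖, sq ‖z‖, congrArg (fun r => ‖s‖ * r) (sq ‖z‖)]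
        linarith [neg_abs_le (L * s z z)]
      rw [hC]
      nlinarith
    rw [cauchySeq_iff_tendsto_dist_atTop_0]
    have hWc : Tendsto (fun n : ℕ × ℕ => ‖W (x (φ n.1)) - W (x (φ n.2))‖) atTop (𝓝 0) := by
      have := (cauchySeq_iff_tendsto_dist_atTop_0.1 hy.cauchySeq)
      simpa [dist_eq_norm] using this
    have hfst : Tendsto (Prod.fst : ℕ × ℕ → ℕ) atTop atTop := by
      rw [← prod_atTop_atTop_eq]; exact tendsto_fst
    have hsnd : Tendsto (Prod.snd : ℕ × ℕ → ℕ) atTop atTop := by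
      rw [← prod_atTop_atTop_eq]; exact tendsto_snd
    have hb := (((hp0.comp hfst).const_mul 2).add ((hp0.comp hsnd).const_mul 2)).add
      ((hWc.pow 2).const_mul C)
    simp only [mul_zero, add_zero, ne_eq, OfNat.ofNat_ne_zero, not_false_eq_true, zero_pow] at hb
    have hsq : Tendsto (fun n : ℕ × ℕ => ‖x (φ n.1) - x (φ n.2)‖ ^ 2) atTop (𝓝 0) :=
      squeeze_zero (fun n => by positivity) (fun n => key n.1 n.2) hb
    have := hsq.sqrt
    simpa [Real.sqrt_sq, dist_eq_norm] using this
  obtain ⟨z, hz⟩ := cauchySeq_tendsto_of_complete hcau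
  have hzM : z ∈ M := hMc.mem_of_tendsto hz (Eventually.of_forall fun n => hxM _)
  have hz1 : ‖z‖ = 1 := by
    have := hz.norm
    simp only [hx1] at this
    exact (tendsto_nhds_unique this tendsto_const_nhds)
  refine ⟨z, hzM, fun h => by simp [h] at hz1, fun w hw => ?_⟩
  have hPz : P z z = 0 := by
    have : Tendsto (fun n => P (x (φ n)) (x (φ n))) atTop (𝓝 (P z z)) :=
      bil_tendsto P hz
    exact tendsto_nhds_unique this hp0
  exact psd_zero P (PF_symm W k s hk hs L) M hLA z hzM hPz w hw

lemma exists_family [CompleteSpace H] (W : H →L[ℝ] F) (hW : SeqCpt W)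
    (k s : F →L[ℝ] F →L[ℝ] ℝ)
    (hk : ∀ x y, k x y = k y x) (hs : ∀ x y, s x y = s y x)
    (hspos : ∀ x, x ≠ 0 → 0 < s x x) (n : ℕ) (v : Fin n → H)
    (hv : ∀ c : Fin n → ℝ, c ≠ 0 → PF W k s 0 (∑ i, c i • v i) (∑ i, c i • v i) < 0) :
    ∀ m ≤ n, ∃ x : Fin m → H, (∀ i, W (x i) ≠ 0) ∧ (∀ i j, i ≠ j → s (W (x i)) (W (x j)) = 0) ∧
      ∀ i, ∃ l : ℝ, 0 < l ∧ ∀ y, PF W k s l (x i) y = 0 := by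
  intro m
  induction m with
  | zero => exact fun _ => ⟨fun i => i.elim0, fun i => i.elim0, fun i => i.elim0, fun i => i.elim0⟩
  | succ m ih =>
    intro hm
    obtain ⟨x, hx0, hxo, hxe⟩ := ih (by omega)
    let T : H →L[ℝ] (Fin m → ℝ) := ContinuousLinearMap.pi fun i => (s (W (x i))).comp W
    have hT : ∀ y i, T y i = s (W (x i)) (W y) := fun y i => rfl
    let M : Submodule ℝ H := LinearMap.ker (T : H →ₗ[ℝ] (Fin m → ℝ))
    have hMmem : ∀ y, y ∈ M ↔ ∀ i, s (W (x i)) (W y) = 0 := by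
      intro y
      rw [LinearMap.mem_ker]
      exact funext_iff
    have hMc : IsClosed (M : Set H) := ContinuousLinearMap.isClosed_ker T
    let Lc : (Fin n → ℝ) →ₗ[ℝ] (Fin m → ℝ) :=
      (T : H →ₗ[ℝ] (Fin m → ℝ)).comp (Fintype.linearCombination ℝ v)
    have hker : LinearMap.ker Lc ≠ ⊥ := LinearMap.ker_ne_bot_of_finrank_lt (by simpa using hm)
    obtain ⟨c, hc, hc0⟩ := (Submodule.ne_bot_iff _).1 hker
    have hcM : (∑ i, c i • v i) ∈ M := by
      have h1 : Lc c = 0 := hc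
      have h2 : Lc c = T (∑ i, c i • v i) := by
        simp only [Lc, LinearMap.comp_apply, Fintype.linearCombination_apply]; rfl
      rw [h2] at h1
      exact h1
    obtain ⟨l, hl, z, hzM, hz0, hz⟩ := exists_eig W hW k s hk hs hspos M hMc _ hcM (hv c hc0)
    have hspos' : ∀ i, s (W (x i)) (W (x i)) ≠ 0 := fun i =>
      (hspos _ (hx0 i)).ne'
    have hzs := (hMmem z).1 hzM
    have hzall : ∀ y, PF W k s l z y = 0 := by
      intro y
      set w := ∑ j, (s (W (x j)) (W y) / s (W (x j)) (W (x j))) • x j with hw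
      have hyw : y - w ∈ M := by
        rw [hMmem]
        intro i
        rw [map_sub, map_sub, hw, map_sum, map_sum, Finset.sum_eq_single i]
        · rw [map_smul, map_smul, smul_eq_mul, div_mul_cancel₀ _ (hspos' i), sub_self]
        · intro j _ hj
          rw [map_smul, map_smul, hxo i j hj.symm, smul_zero]
        · simp
      have hzx : ∀ i, PF W k s l z (x i) = 0 := by
        intro i
        obtain ⟨l', -, hl'⟩ := hxe i
        have h1 := hl' z
        rw [PF_apply, hzs i] at h1
        rw [PF_symm W k s hk hs, PF_apply, hzs i]
        linarith
      have hzw : PF W k s l z w = 0 := by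
        rw [hw, map_sum]
        refine Finset.sum_eq_zero fun i _ => ?_
        rw [map_smul, hzx, smul_zero]
      have := hz _ hyw
      rw [map_sub, hzw, sub_zero] at this
      exact this
    refine ⟨Fin.cons z x, ?_, ?_, ?_⟩
    · intro i
      refine Fin.cases ?_ (fun i => ?_) i
      · simp only [Fin.cons_zero]
        intro h
        have h1 := hzall z
        rw [PF_apply, h] at h1
        simp at h1
        exact hz0 h1
      · simpa using hx0 i
    · intro i j
      refine Fin.cases ?_ (fun i => ?_) i
      · refine Fin.cases ?_ (fun j => ?_) j
        · simp
        · intro _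
          simp only [Fin.cons_zero, Fin.cons_succ]
          rw [hs]; exact hzs j
      · refine Fin.cases ?_ (fun j => ?_) j
        · intro _
          simp only [Fin.cons_zero, Fin.cons_succ]
          exact hzs i
        · intro h
          simp only [Fin.cons_succ]
          exact hxo i j (fun h' => h (by rw [h']))
    · intro i
      refine Fin.cases ?_ (fun i => ?_) i
      · simpa using ⟨l, hl, hzall⟩
      · simpa using hxe i

lemma indep_of_orth (W : H →L[ℝ] F) (s : F →L[ℝ] F →L[ℝ] ℝ)
    (hspos : ∀ x, x ≠ 0 → 0 < s x x) (n : ℕ) (x : Fin n → H)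
    (hx0 : ∀ i, W (x i) ≠ 0) (hxo : ∀ i j, i ≠ j → s (W (x i)) (W (x j)) = 0) (c : Fin n → ℝ)
    (hc : ∑ i, c i • W (x i) = 0) : c = 0 := by
  funext i
  have h1 : s (W (x i)) (∑ j, c j • W (x j)) = 0 := by rw [hc, map_zero]
  rw [map_sum, Finset.sum_eq_single i] at h1
  · rw [map_smul, smul_eq_mul] at h1
    exact (mul_eq_zero.1 h1).resolve_right
      (hspos _ (hx0 i)).ne'
  · intro j _ hj
    rw [map_smul, hxo i j hj.symm, smul_zero]
  · simp

lemma neg_bdd (W : H →L[ℝ] F) (K : Set F) (hK : IsCompact K) (hWK : ∀ x, ‖x‖ ≤ 1 → W x ∈ K)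
    (k s : F →L[ℝ] F →L[ℝ] ℝ) :
    ∃ N : ℕ, ∀ (n : ℕ) (v : Fin n → H),
    (∀ c : Fin n → ℝ, c ≠ 0 → PF W k s 0 (∑ i, c i • v i) (∑ i, c i • v i) < 0) → n ≤ N := by
  set C := ‖k‖ + 1 with hC
  have hC0 : 0 < C := by positivity
  obtain ⟨e, he, heC⟩ : ∃ e : ℝ, 0 < e ∧ C * (2 * e) ^ 2 < 2 := by
    refine ⟨1 / (2 * C), by positivity, ?_⟩
    have h1 : 1 ≤ C := by rw [hC]; linarith [norm_nonneg k]
    have : C * (2 * (1 / (2 * C))) ^ 2 = 1 / C := by field_simp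
    rw [this, div_lt_iff₀ hC0]; linarith
  obtain ⟨t, -, htf, ht⟩ := hK.finite_cover_balls he
  refine ⟨htf.toFinset.card, fun n v hv => ?_⟩
  have hli : LinearIndependent ℝ v := by
    rw [Fintype.linearIndependent_iff]
    intro g hg
    by_contra! h
    have := hv g (fun h' => by obtain ⟨i, hi⟩ := h; exact hi (by rw [h']; rfl))
    rw [hg] at this
    simp at this
  let S := Submodule.span ℝ (Set.range v)
  have hfr : Module.finrank ℝ S = n := by simpa using finrank_span_eq_card hli
  have : FiniteDimensional ℝ S := FiniteDimensional.span_of_finite ℝ (Set.finite_range v)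
  let o := (stdOrthonormalBasis ℝ S).reindex (finCongr hfr)
  have hneg : ∀ x ∈ S, x ≠ 0 → PF W k s 0 x x < 0 := by
    intro x hx hx0
    obtain ⟨c, rfl⟩ := (Submodule.mem_span_range_iff_exists_fun ℝ).1 hx
    refine hv c fun h => hx0 (by simp [h])
  have hmem : ∀ i, W (o i : H) ∈ ⋃ x ∈ t, Metric.ball x e := by
    intro i
    refine ht (hWK _ ?_)
    have := o.orthonormal.1 i
    rw [Submodule.coe_norm] at *
    exact this.le
  simp only [Set.mem_iUnion, exists_prop] at hmem
  choose p hp hpb using hmem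
  have hinj : Function.Injective p := by
    intro i j hij
    by_contra hne
    set d : H := (o i : H) - (o j : H) with hd
    have hdS : d ∈ S := S.sub_mem (o i).2 (o j).2
    have hin : ∀ a b, ⟪(o a : H), (o b : H)⟫ = if a = b then 1 else 0 := by
      intro a b
      have := (orthonormal_iff_ite.1 o.orthonormal) a b
      rw [← this]; rfl
    have hdd : ⟪d, d⟫ = 2 := by
      rw [hd, inner_sub_left, inner_sub_right, inner_sub_right, hin, hin, hin, hin]
      simp [hne, Ne.symm hne]; norm_num
    have hd0 : d ≠ 0 := by rintro h; rw [h] at hdd; simp at hdd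
    have h1 := hneg d hdS hd0
    rw [PF_apply, hdd] at h1
    have hWd : ‖W d‖ < 2 * e := by
      rw [hd, map_sub, ← dist_eq_norm]
      have a1 := hpb i
      have a2 := hpb j
      rw [← hij] at a2
      rw [Metric.mem_ball] at a1 a2
      calc _ ≤ dist (W (o i : H)) (p i) + dist (W (o j : H)) (p i) := dist_triangle_right _ _ _
        _ < _ := by linarith
    have h2 := k.le_opNorm₂ (W d) (W d)
    rw [Real.norm_eq_abs] at h2
    have h3 : ‖k‖ * ‖W d‖ * ‖W d‖ ≤ C * (2 * e) ^ 2 := by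
      rw [mul_assoc, sq]
      have := mul_le_mul hWd.le hWd.le (norm_nonneg _) (by linarith)
      exact mul_le_mul (by rw [hC]; linarith) this (by positivity) hC0.le
    linarith [le_abs_self (k (W d) (W d))]
  have := Finset.card_le_card_of_injOn (s := Finset.univ) (t := htf.toFinset) p
    (fun i _ => by simpa using hp i) (fun a _ b _ h => hinj h)
  simpa using this

lemma neg_of_eig (W : H →L[ℝ] F) (k s : F →L[ℝ] F →L[ℝ] ℝ)
    (hk : ∀ x y, k x y = k y x) (hs : ∀ x y, s x y = s y x)
    (hspos : ∀ x, x ≠ 0 → 0 < s x x) (n : ℕ) (x : Fin n → H) (l : Fin n → ℝ)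
    (hl : ∀ i, 0 < l i) (hx : ∀ i j, PF W k s (l i) (x i) (x j) = 0)
    (hind : ∀ c : Fin n → ℝ, ∑ i, c i • W (x i) = 0 → c = 0) (c : Fin n → ℝ) (hc : c ≠ 0) :
    PF W k s 0 (∑ i, c i • x i) (∑ i, c i • x i) < 0 := by
  have h0 : ∀ i j, PF W k s 0 (x i) (x j) = -(l i * s (W (x i)) (W (x j))) := by
    intro i j
    have := hx i j
    rw [PF_apply] at *
    linarith
  have h1 : ∀ i j, l i * s (W (x i)) (W (x j)) =
      √(l i) * √(l j) * s (W (x i)) (W (x j)) := by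
    intro i j
    have a := h0 i j
    rw [PF_symm W k s hk hs, h0 j i, hs] at a
    have : (l i - l j) * s (W (x i)) (W (x j)) = 0 := by linarith
    rcases mul_eq_zero.1 this with h | h
    · have : l i = l j := by linarith
      rw [← this, Real.mul_self_sqrt (hl i).le]
    · rw [h]; simp
  have h2 : PF W k s 0 (∑ i, c i • x i) (∑ i, c i • x i) =
      - s (W (∑ i, (c i * √(l i)) • x i)) (W (∑ i, (c i * √(l i)) • x i)) := by
    simp only [map_sum, map_smul, sum_apply, smul_apply,
      smul_eq_mul, h0, h1, Finset.mul_sum, ← Finset.sum_neg_distrib]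
    refine Finset.sum_congr rfl fun i _ => Finset.sum_congr rfl fun j _ => by ring
  rw [h2, neg_lt_zero]
  apply hspos
  intro h
  have h3 := hind (fun i => c i * √(l i)) (by simpa only [map_sum, map_smul] using h)
  apply hc
  funext i
  have := congrFun h3 i
  simpa [(Real.sqrt_pos.2 (hl i)).ne'] using this
end abstr

section conc
open Filter Topology MeasureTheory
set_option linter.unusedSectionVars false
variable {E : Type*} [NormedAddCommGroup E] [InnerProductSpace ℝ E] [FiniteDimensional ℝ E]

noncomputable abbrev mu (τ : ℝ) : Measure ℝ := volume.restrict (Set.Ioc 0 τ)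

lemma mu_real_le (τ a b : ℝ) (hab : a ≤ b) : (mu τ).real (Set.Ioc a b) ≤ b - a := by
  rw [measureReal_restrict_apply measurableSet_Ioc]
  calc _ ≤ volume.real (Set.Ioc a b) := measureReal_mono Set.inter_subset_left (by simp)
    _ = b - a := by simp [hab]

lemma setint_bound (τ : ℝ) (f : Lp E 2 (mu τ)) (s : Set ℝ) (hs : MeasurableSet s) :
    ‖∫ x in s, f x ∂(mu τ)‖ ≤ √((mu τ).real s) * ‖f‖ := by
  set c := ∫ x in s, f x ∂(mu τ) with hc
  have h1 := L2.inner_indicatorConstLp_eq_inner_setIntegral (𝕜 := ℝ) hs (measure_ne_top (mu τ) s) c f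
  rw [← hc, real_inner_self_eq_norm_sq] at h1
  have h2 := real_inner_le_norm (indicatorConstLp 2 hs (measure_ne_top (mu τ) s) c) f
  rw [h1, norm_indicatorConstLp (by simp) (by simp)] at h2
  have h3 : (mu τ).real s ^ (1 / (2 : ENNReal).toReal) = √((mu τ).real s) := by
    rw [Real.sqrt_eq_rpow]; simp
  rw [h3] at h2
  by_cases h : ‖c‖ = 0
  · rw [h]; positivity
  · have hp : 0 < ‖c‖ := lt_of_le_of_ne (norm_nonneg _) (Ne.symm h)
    have : ‖c‖ * ‖c‖ ≤ ‖c‖ * (√((mu τ).real s) * ‖f‖) := by nlinarith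
    exact le_of_mul_le_mul_left this hp

noncomputable def Wf (τ : ℝ) (f : ℝ → E) (t : ℝ) : E := -∫ s in Set.Ioc t τ, f s ∂(mu τ)

lemma lp_int (τ : ℝ) (f : Lp E 2 (mu τ)) : Integrable f (mu τ) :=
  (Lp.memLp f).integrable (by norm_num)

lemma Wf_sub (τ : ℝ) (f : Lp E 2 (mu τ)) (s t : ℝ) (hst : s ≤ t) (htτ : t ≤ τ) :
    Wf τ f t - Wf τ f s = ∫ x in Set.Ioc s t, f x ∂(mu τ) := by
  have : Set.Ioc s τ = Set.Ioc s t ∪ Set.Ioc t τ := (Set.Ioc_union_Ioc_eq_Ioc hst htτ).symm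
  rw [Wf, Wf, this, setIntegral_union (Set.Ioc_disjoint_Ioc_of_le le_rfl) measurableSet_Ioc
    (lp_int τ f).integrableOn (lp_int τ f).integrableOn]
  abel

lemma Wf_dist (τ : ℝ) (f : Lp E 2 (mu τ)) (s t : ℝ) (hs : s ≤ τ) (ht : t ≤ τ) :
    ‖Wf τ f t - Wf τ f s‖ ≤ √|t - s| * ‖f‖ := by
  wlog hst : s ≤ t generalizing s t
  · rw [norm_sub_rev, abs_sub_comm]; exact this t s ht hs (le_of_not_ge hst)
  rw [Wf_sub τ f s t hst ht]
  refine (setint_bound τ f _ measurableSet_Ioc).trans ?_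
  refine mul_le_mul_of_nonneg_right (Real.sqrt_le_sqrt ?_) (norm_nonneg _)
  rw [abs_of_nonneg (by linarith)]
  exact mu_real_le τ s t hst

lemma Wf_tau (τ : ℝ) (f : ℝ → E) : Wf τ f τ = 0 := by simp [Wf]

lemma Wf_norm (τ : ℝ) (f : Lp E 2 (mu τ)) (t : ℝ) (ht : t ∈ Set.Icc 0 τ) :
    ‖Wf τ f t‖ ≤ √τ * ‖f‖ := by
  have := Wf_dist τ f τ t le_rfl ht.2
  rw [Wf_tau, sub_zero] at this
  refine this.trans (mul_le_mul_of_nonneg_right (Real.sqrt_le_sqrt ?_) (norm_nonneg _))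
  rw [abs_sub_comm, abs_of_nonneg (by linarith [ht.2])]
  linarith [ht.1]

lemma Wf_cont (τ : ℝ) (f : Lp E 2 (mu τ)) : Continuous fun t : Set.Icc 0 τ => Wf τ f t := by
  rw [continuous_iff_continuousAt]
  intro t
  rw [ContinuousAt, tendsto_iff_norm_sub_tendsto_zero]
  have h1 : Tendsto (fun x : Set.Icc 0 τ => √|(x:ℝ) - t| * ‖f‖) (𝓝 t) (𝓝 (√|(t:ℝ) - t| * ‖f‖)) := by
    have : Continuous (fun x : Set.Icc 0 τ => √|(x:ℝ) - t| * ‖f‖) := by fun_prop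
    exact this.tendsto t
  simp only [sub_self, abs_zero, Real.sqrt_zero, zero_mul] at h1
  exact squeeze_zero (fun _ => norm_nonneg _) (fun x => Wf_dist τ f t x t.2.2 x.2.2) h1

noncomputable def WL (τ : ℝ) : Lp E 2 (mu τ) →L[ℝ] BoundedContinuousFunction (Set.Icc 0 τ) E :=
  LinearMap.mkContinuous
    { toFun := fun f => BoundedContinuousFunction.mkOfCompact ⟨_, Wf_cont τ f⟩
      map_add' := by
        intro f g
        ext t
        simp only [BoundedContinuousFunction.mkOfCompact_apply, ContinuousMap.coe_mk,
          BoundedContinuousFunction.coe_add, Pi.add_apply, Wf]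
        rw [← neg_add, ← integral_add (lp_int τ f).integrableOn (lp_int τ g).integrableOn]
        congr 1
        exact integral_congr_ae (ae_restrict_of_ae (Lp.coeFn_add f g))
      map_smul' := by
        intro c f
        ext t
        simp only [BoundedContinuousFunction.mkOfCompact_apply, ContinuousMap.coe_mk,
          BoundedContinuousFunction.coe_smul, RingHom.id_apply, Wf]
        rw [smul_neg, ← integral_smul]
        congr 1
        exact integral_congr_ae (ae_restrict_of_ae (Lp.coeFn_smul c f)) }
    (√τ) (by
      intro f
      rw [BoundedContinuousFunction.norm_le (by positivity)]
      intro t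
      exact Wf_norm τ f t t.2)

lemma WL_apply (τ : ℝ) (f : Lp E 2 (mu τ)) (t : Set.Icc 0 τ) : WL τ f t = Wf τ f t := rfl

lemma WL_cpt (τ : ℝ) : ∃ K : Set (BoundedContinuousFunction (Set.Icc 0 τ) E), IsCompact K ∧
    ∀ f : Lp E 2 (mu τ), ‖f‖ ≤ 1 → WL τ f ∈ K := by
  refine ⟨closure (WL τ '' {f | ‖f‖ ≤ 1}), ?_, fun f hf => subset_closure ⟨f, hf, rfl⟩⟩
  have : ProperSpace E := FiniteDimensional.proper ℝ E
  refine BoundedContinuousFunction.arzela_ascoli (Metric.closedBall 0 (√τ))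
    (isCompact_closedBall _ _) _ ?_ ?_
  · rintro _ t ⟨f, hf, rfl⟩
    rw [mem_closedBall_zero_iff, WL_apply]
    refine (Wf_norm τ f t t.2).trans ?_
    have hf' : ‖f‖ ≤ 1 := hf
    nlinarith [Real.sqrt_nonneg τ]
  · refine Metric.equicontinuous_of_continuity_modulus (fun x => √x) ?_ _ ?_
    · have := Real.continuous_sqrt.tendsto 0
      simpa using this
    · rintro x y ⟨_, ⟨f, hf, rfl⟩⟩
      have hf' : ‖f‖ ≤ 1 := hf
      simp only [WL_apply, dist_eq_norm]
      refine (Wf_dist τ f y x y.2.2 x.2.2).trans ?_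
      rw [Subtype.dist_eq, Real.dist_eq]
      nlinarith [Real.sqrt_nonneg |(x:ℝ) - y|]

noncomputable def exF (τ : ℝ) (hτ : 0 < τ) (u : BoundedContinuousFunction (Set.Icc 0 τ) E) (t : ℝ) : E :=
  u (Set.projIcc 0 τ hτ.le t)

lemma exF_cont (τ : ℝ) (hτ : 0 < τ) (u : BoundedContinuousFunction (Set.Icc 0 τ) E) :
    Continuous (exF τ hτ u) := u.continuous.comp continuous_projIcc

lemma exF_of_mem (τ : ℝ) (hτ : 0 < τ) (u : BoundedContinuousFunction (Set.Icc 0 τ) E) (t : ℝ)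
    (ht : t ∈ Set.Icc 0 τ) : exF τ hτ u t = u ⟨t, ht⟩ := by
  rw [exF, Set.projIcc_of_mem hτ.le ht]

lemma exists_form (τ : ℝ) (hτ : 0 < τ) (A : ℝ → E →L[ℝ] E) (hA : Continuous A)
    (q : E →ₗ[ℝ] E →ₗ[ℝ] ℝ) :
    ∃ B : BoundedContinuousFunction (Set.Icc 0 τ) E →L[ℝ]
      BoundedContinuousFunction (Set.Icc 0 τ) E →L[ℝ] ℝ,
      ∀ u w, B u w = q (exF τ hτ u 0) (exF τ hτ w 0) +
        ∫ t in (0:ℝ)..τ, ⟪A t (exF τ hτ u t), exF τ hτ w t⟫ := by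
  obtain ⟨C, hC⟩ := (isCompact_Icc (a := (0:ℝ)) (b := τ)).exists_bound_of_continuousOn hA.continuousOn
  have hCn : 0 ≤ C := (norm_nonneg _).trans (hC 0 ⟨le_rfl, hτ.le⟩)
  obtain ⟨D, hD⟩ : ∃ D : ℝ, ∀ x y, ‖q x y‖ ≤ D * ‖x‖ * ‖y‖ := by
    let q1 : E →ₗ[ℝ] E →L[ℝ] ℝ := (LinearMap.toContinuousLinearMap : (E →ₗ[ℝ] ℝ) ≃ₗ[ℝ] _).toLinearMap.comp q
    exact ⟨‖LinearMap.toContinuousLinearMap q1‖, fun x y =>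
      (LinearMap.toContinuousLinearMap q1).le_opNorm₂ x y⟩
  have hext : ∀ (u : BoundedContinuousFunction (Set.Icc 0 τ) E) t, ‖exF τ hτ u t‖ ≤ ‖u‖ :=
    fun u t => u.norm_coe_le_norm _
  have hint : ∀ u w : BoundedContinuousFunction (Set.Icc 0 τ) E, IntervalIntegrable
      (fun t => ⟪A t (exF τ hτ u t), exF τ hτ w t⟫) volume 0 τ := fun u w =>
    ((hA.clm_apply (exF_cont τ hτ u)).inner (exF_cont τ hτ w)).intervalIntegrable _ _
  have e1 : ∀ u v t, exF τ hτ (u + v) t = (exF τ hτ u t : E) + exF τ hτ v t := fun _ _ _ => rfl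
  have e2 : ∀ (c : ℝ) u t, exF τ hτ (c • u) t = c • (exF τ hτ u t : E) := fun _ _ _ => rfl
  refine ⟨LinearMap.mkContinuous₂ (LinearMap.mk₂ ℝ (fun u w => q (exF τ hτ u 0) (exF τ hτ w 0) +
        ∫ t in (0:ℝ)..τ, ⟪A t (exF τ hτ u t), exF τ hτ w t⟫) ?_ ?_ ?_ ?_) (|D| + C * τ) ?_, fun u w => rfl⟩
  · intro u v w
    simp only [e1, map_add, inner_add_left, LinearMap.add_apply]
    rw [intervalIntegral.integral_add (hint u w) (hint v w)]; ring
  · intro c u w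
    simp only [e2, map_smul, inner_smul_left, LinearMap.smul_apply]
    rw [intervalIntegral.integral_const_mul]; simp; ring
  · intro u v w
    simp only [e1, map_add, inner_add_right]
    rw [intervalIntegral.integral_add (hint u v) (hint u w)]; ring
  · intro c u w
    simp only [e2, map_smul, inner_smul_right]
    rw [intervalIntegral.integral_const_mul]; simp; ring
  · intro u w
    simp only [LinearMap.mk₂_apply]
    refine (norm_add_le _ _).trans ?_
    have h1 : ‖q (exF τ hτ u 0) (exF τ hτ w 0)‖ ≤ |D| * ‖u‖ * ‖w‖ := by
      refine (hD _ _).trans ?_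
      refine mul_le_mul (mul_le_mul (le_abs_self D) (hext u 0) (norm_nonneg _) (abs_nonneg _))
        (hext w 0) (norm_nonneg _) (by positivity)
    have h2 := intervalIntegral.norm_integral_le_of_norm_le_const (a := 0) (b := τ)
      (f := fun t => ⟪A t (exF τ hτ u t), exF τ hτ w t⟫) (C := C * ‖u‖ * ‖w‖) (fun t ht => by
        rw [Set.uIoc_of_le hτ.le] at ht
        refine (norm_inner_le_norm _ _).trans ?_
        refine mul_le_mul (((A t).le_opNorm _).trans ?_) (hext w t) (norm_nonneg _) (by positivity)
        exact mul_le_mul (hC t ⟨ht.1.le, ht.2⟩) (hext u t) (norm_nonneg _) hCn)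
    rw [sub_zero, abs_of_pos hτ] at h2
    nlinarith

lemma l2_pos (τ : ℝ) (hτ : 0 < τ) (u : BoundedContinuousFunction (Set.Icc 0 τ) E) (hu : u ≠ 0) :
    0 < ∫ t in (0:ℝ)..τ, ⟪exF τ hτ u t, exF τ hτ u t⟫ := by
  obtain ⟨t, ht⟩ : ∃ t, u t ≠ 0 := by
    by_contra! h
    exact hu (by ext t; simp [h])
  refine intervalIntegral.integral_pos hτ ((exF_cont τ hτ u).inner (exF_cont τ hτ u)).continuousOn
    (fun _ _ => real_inner_self_nonneg) ⟨t, t.2, ?_⟩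
  rw [exF_of_mem τ hτ u t t.2]
  exact real_inner_self_pos.2 ht
end conc

section conc2
open Filter Topology MeasureTheory
set_option linter.unusedSectionVars false
variable {E : Type*} [NormedAddCommGroup E] [InnerProductSpace ℝ E] [FiniteDimensional ℝ E]

lemma mu_restrict (τ t : ℝ) (ht : 0 ≤ t) : (mu τ).restrict (Set.Ioc t τ) = volume.restrict (Set.Ioc t τ) := by
  rw [Measure.restrict_restrict measurableSet_Ioc, Set.inter_eq_left.2]
  exact Set.Ioc_subset_Ioc_left ht

lemma Wf_eq (τ : ℝ) (f : ℝ → E) (t : ℝ) (ht : t ∈ Set.Icc 0 τ) : Wf τ f t = -∫ s in t..τ, f s := by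
  rw [Wf, mu_restrict τ t ht.1, intervalIntegral.integral_of_le ht.2]

lemma Wf_congr (τ : ℝ) (f g : ℝ → E) (h : f =ᵐ[mu τ] g) (t : ℝ) : Wf τ f t = Wf τ g t := by
  rw [Wf, Wf, integral_congr_ae (ae_restrict_of_ae h)]

lemma int_mu (τ : ℝ) (hτ : 0 < τ) {G : Type*} [NormedAddCommGroup G] [NormedSpace ℝ G] (f : ℝ → G) :
    ∫ t, f t ∂(mu τ) = ∫ t in (0:ℝ)..τ, f t := by
  rw [intervalIntegral.integral_of_le hτ.le]

lemma Wf_zero (τ : ℝ) (hτ : 0 < τ) (f : ℝ → E) : ∫ t, f t ∂(mu τ) = - Wf τ f 0 := by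
  rw [Wf_eq τ f 0 ⟨le_rfl, hτ.le⟩, neg_neg, int_mu τ hτ]

lemma exF_WL (τ : ℝ) (hτ : 0 < τ) (f : Lp E 2 (mu τ)) (t : ℝ) (ht : t ∈ Set.Icc 0 τ) :
    exF τ hτ (WL τ f) t = Wf τ f t := by
  rw [exF_of_mem τ hτ _ t ht, WL_apply]

lemma cont_memLp (τ : ℝ) (g : ℝ → E) (hg : Continuous g) : MemLp g 2 (mu τ) := by
  obtain ⟨C, hC⟩ := (isCompact_Icc (a := (0:ℝ)) (b := τ)).exists_bound_of_continuousOn hg.continuousOn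
  refine MemLp.of_bound hg.aestronglyMeasurable C ?_
  refine (ae_restrict_iff' measurableSet_Ioc).2 (Eventually.of_forall fun t ht => hC t ⟨ht.1.le, ht.2⟩)

lemma inner_const (τ : ℝ) (m : E) (h : Lp E 2 (mu τ)) :
    ⟪Lp.const 2 (mu τ) m, h⟫ = ⟪m, ∫ t, h t ∂(mu τ)⟫ := by
  rw [L2.inner_def, ← integral_inner (lp_int τ h)]
  refine integral_congr_ae ?_
  filter_upwards [Lp.coeFn_const 2 (mu τ) m] with t ht
  rw [ht]; rfl

lemma inner_toLp (τ : ℝ) (g : ℝ → E) (hg : MemLp g 2 (mu τ)) (h : Lp E 2 (mu τ)) :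
    ⟪hg.toLp g, h⟫ = ∫ t, ⟪g t, h t⟫ ∂(mu τ) := by
  rw [L2.inner_def]
  refine integral_congr_ae ?_
  filter_upwards [hg.coeFn_toLp] with t ht
  rw [ht]

lemma ibp (τ : ℝ) (hτ : 0 < τ) (g G : ℝ → E) (hg : Continuous g) (hG : ∀ t, HasDerivAt G (g t) t)
    (hG0 : G 0 = 0) (hGm : MemLp G 2 (mu τ)) (h : Lp E 2 (mu τ)) :
    ∫ t in (0:ℝ)..τ, ⟪g t, exF τ hτ (WL τ h) t⟫ = -⟪hGm.toLp G, h⟫ := by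
  obtain ⟨B, hB⟩ := exists_form (E := E) τ hτ (fun _ => ContinuousLinearMap.id ℝ E) continuous_const 0
  let gr : BoundedContinuousFunction (Set.Icc 0 τ) E :=
    BoundedContinuousFunction.mkOfCompact ⟨fun t : Set.Icc 0 τ => g t, by fun_prop⟩
  have hgr : ∀ t ∈ Set.Icc 0 τ, exF τ hτ gr t = g t := fun t ht => by
    rw [exF_of_mem τ hτ _ t ht]; rfl
  have hL : ∀ h : Lp E 2 (mu τ), ∫ t in (0:ℝ)..τ, ⟪g t, exF τ hτ (WL τ h) t⟫ = B gr (WL τ h) := by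
    intro h
    rw [hB]
    simp only [LinearMap.zero_apply, zero_add, ContinuousLinearMap.id_apply]
    refine intervalIntegral.integral_congr fun t ht => ?_
    rw [Set.uIcc_of_le hτ.le] at ht
    simp only [hgr t ht]
  rw [hL]
  have hd := BoundedContinuousFunction.toLp_denseRange (E := E) (p := 2) (mu τ) ℝ ENNReal.ofNat_ne_top
  have hc : Continuous fun h : Lp E 2 (mu τ) => B gr (WL τ h) := by fun_prop
  have hc2 : Continuous fun h : Lp E 2 (mu τ) => -⟪hGm.toLp G, h⟫ := by fun_prop
  refine congrFun (hd.equalizer hc hc2 (funext fun φ => ?_)) h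
  simp only [Function.comp_apply]
  rw [← hL, inner_toLp, int_mu τ hτ]
  set h := (BoundedContinuousFunction.toLp 2 (mu τ) ℝ) φ with hh
  have hφ : h =ᵐ[mu τ] φ := BoundedContinuousFunction.coeFn_toLp 2 (mu τ) ℝ φ
  let w : ℝ → E := fun t => -∫ s in t..τ, φ s
  have hw : ∀ t, HasDerivAt w (φ t) t := by
    intro t
    have := (intervalIntegral.integral_hasDerivAt_left (φ.continuous.intervalIntegrable t τ)
      (φ.continuous.stronglyMeasurableAtFilter _ _) φ.continuous.continuousAt).neg
    rw [neg_neg] at this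
    exact this
  have e1 : ∫ t in (0:ℝ)..τ, ⟪g t, exF τ hτ (WL τ h) t⟫ = ∫ t in (0:ℝ)..τ, ⟪g t, w t⟫ := by
    refine intervalIntegral.integral_congr fun t ht => ?_
    rw [Set.uIcc_of_le hτ.le] at ht
    simp only [exF_WL τ hτ h t ht]
    rw [Wf_congr τ _ _ hφ, Wf_eq τ _ t ht]
  have e2 : ∫ t in (0:ℝ)..τ, ⟪G t, h t⟫ = ∫ t in (0:ℝ)..τ, ⟪G t, φ t⟫ := by
    rw [← int_mu τ hτ, ← int_mu τ hτ]
    refine integral_congr_ae ?_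
    filter_upwards [hφ] with t ht
    rw [ht]
  rw [e1, e2]
  have hGc : Continuous G := continuous_iff_continuousAt.2 fun t => (hG t).continuousAt
  have hwc : Continuous w := continuous_iff_continuousAt.2 fun t => (hw t).continuousAt
  have i1 : IntervalIntegrable (fun t => ⟪G t, φ t⟫) volume 0 τ :=
    (hGc.inner φ.continuous).intervalIntegrable _ _
  have i2 : IntervalIntegrable (fun t => ⟪g t, w t⟫) volume 0 τ :=
    (hg.inner hwc).intervalIntegrable _ _
  have := intervalIntegral.integral_eq_sub_of_hasDerivAt (a := 0) (b := τ)
    (fun t _ => (hG t).inner ℝ (hw t)) (i1.add i2)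
  rw [intervalIntegral.integral_add i1 i2, hG0] at this
  have hwτ : w τ = 0 := by simp [w]
  rw [hwτ, inner_zero_right, inner_zero_left, sub_zero] at this
  linarith

lemma regularity (τ : ℝ) (hτ : 0 < τ) (E₀ : Submodule ℝ E) (A : ℝ → E →L[ℝ] E) (hA : Continuous A)
    (p : E) (f : Lp E 2 (mu τ))
    (hf : ∀ h : Lp E 2 (mu τ), ∫ t, h t ∂(mu τ) ∈ E₀ → ⟪f, h⟫ + ⟪p, ∫ t, h t ∂(mu τ)⟫ -
      ∫ t in (0:ℝ)..τ, ⟪A t (exF τ hτ (WL τ f) t), exF τ hτ (WL τ h) t⟫ = 0) :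
    ∃ u u' : ℝ → E, (∀ t, HasDerivAt u (u' t) t) ∧
      (∀ t, HasDerivAt u' (-(A t (exF τ hτ (WL τ f) t))) t) ∧
      (∀ t ∈ Set.Icc 0 τ, u t = Wf τ f t) ∧ ∀ e ∈ E₀, ⟪u' 0 + p, e⟫ = 0 := by
  set g : ℝ → E := fun t => A t (exF τ hτ (WL τ f) t) with hgdef
  have hg : Continuous g := hA.clm_apply (exF_cont τ hτ _)
  let G : ℝ → E := fun t => ∫ s in (0:ℝ)..t, g s
  have hG : ∀ t, HasDerivAt G (g t) t := fun t =>
    intervalIntegral.integral_hasDerivAt_right (hg.intervalIntegrable 0 t)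
      (hg.stronglyMeasurableAtFilter _ _) hg.continuousAt
  have hGc : Continuous G := continuous_iff_continuousAt.2 fun t => (hG t).continuousAt
  have hG0 : G 0 = 0 := by simp [G]
  have hGm := cont_memLp τ G hGc
  set Φ : Lp E 2 (mu τ) := f + Lp.const 2 (mu τ) p + hGm.toLp G with hΦ
  have hweak : ∀ h : Lp E 2 (mu τ), ∫ t, h t ∂(mu τ) ∈ E₀ → ⟪Φ, h⟫ = 0 := by
    intro h hh
    have := hf h hh
    rw [ibp τ hτ g G hg hG hG0 hGm h] at this
    rw [hΦ, inner_add_left, inner_add_left, inner_const]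
    linarith
  set m : E := τ⁻¹ • ∫ t, Φ t ∂(mu τ) with hm
  have hconst : ∀ e : E, ∫ t, (Lp.const 2 (mu τ) e) t ∂(mu τ) = τ • e := by
    intro e
    rw [integral_congr_ae (Lp.coeFn_const 2 (mu τ) e)]
    simp [hτ.le]
  set h : Lp E 2 (mu τ) := Φ - Lp.const 2 (mu τ) m with hh
  have hint : ∫ t, h t ∂(mu τ) = 0 := by
    have : ∫ t, h t ∂(mu τ) = ∫ t, (Φ t - (Lp.const 2 (mu τ) m) t) ∂(mu τ) :=
      integral_congr_ae (Lp.coeFn_sub _ _)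
    rw [this, integral_sub (lp_int τ _) (lp_int τ _), hconst, hm, smul_inv_smul₀ hτ.ne', sub_self]
  have hh0 : h = 0 := by
    have h1 := hweak h (by rw [hint]; exact E₀.zero_mem)
    have h2 := inner_const τ m h
    rw [hint, inner_zero_right] at h2
    have h3 : ⟪h, h⟫ = 0 := by
      conv_lhs => rw [hh, inner_sub_left, ← hh]
      rw [h1, h2, sub_zero]
    exact inner_self_eq_zero.1 h3
  have hΦm : Φ = Lp.const 2 (mu τ) m := sub_eq_zero.1 hh0
  have hmE : ∀ e ∈ E₀, ⟪m, e⟫ = 0 := by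
    intro e he
    have := hweak (Lp.const 2 (mu τ) e) (by rw [hconst]; exact E₀.smul_mem _ he)
    rw [hΦm, inner_const, hconst, inner_smul_right] at this
    exact (mul_eq_zero.1 this).resolve_left hτ.ne'
  let u' : ℝ → E := fun t => m - p - G t
  have hu'c : Continuous u' := by fun_prop
  have hfu : f =ᵐ[mu τ] u' := by
    have : f = Lp.const 2 (mu τ) m - Lp.const 2 (mu τ) p - hGm.toLp G := by
      rw [← hΦm, hΦ]; abel
    rw [this]
    filter_upwards [Lp.coeFn_sub (Lp.const 2 (mu τ) m - Lp.const 2 (mu τ) p) (hGm.toLp G),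
      Lp.coeFn_sub (Lp.const 2 (mu τ) m) (Lp.const 2 (mu τ) p), Lp.coeFn_const 2 (mu τ) m,
      Lp.coeFn_const 2 (mu τ) p, hGm.coeFn_toLp] with t h1 h2 h3 h4 h5
    rw [h1, Pi.sub_apply, h2, Pi.sub_apply, h3, h4, h5]; rfl
  refine ⟨fun t => -∫ s in t..τ, u' s, u', ?_, ?_, ?_, ?_⟩
  · intro t
    have := (intervalIntegral.integral_hasDerivAt_left (hu'c.intervalIntegrable t τ)
      (hu'c.stronglyMeasurableAtFilter _ _) hu'c.continuousAt).neg
    rw [neg_neg] at this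
    exact this
  · intro t
    exact (hG t).const_sub (m - p)
  · intro t ht
    rw [Wf_congr τ _ _ hfu, Wf_eq τ _ t ht]
  · intro e he
    simp only [u', hG0, sub_zero, sub_add_cancel]
    exact hmE e he
end conc2

section conc3
open Filter Topology MeasureTheory
set_option linter.unusedSectionVars false
variable {E : Type*} [NormedAddCommGroup E] [InnerProductSpace ℝ E] [FiniteDimensional ℝ E]

lemma part_mem {k : ℕ} (s : Fin (k + 1) → ℝ) (t : ℝ) (h0 : s 0 < t) (h1 : t < s (Fin.last k))
    (ht : ∀ j, s j ≠ t) : ∃ i : Fin k, t ∈ Set.Ioo (s i.castSucc) (s i.succ) := by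
  by_contra! hcon
  have : ∀ j : Fin (k + 1), s j < t := by
    intro j
    induction j using Fin.induction with
    | zero => exact h0
    | succ i ih =>
      by_contra hle
      exact hcon i ⟨ih, lt_of_le_of_ne (not_lt.1 hle) (ht _).symm⟩
  exact lt_asymm h1 (this _)

lemma pw_deriv (v : ℝ → E) (a b : ℝ) (hv : PiecewiseContDiffOn 2 v a b) :
    ∃ (S : Set ℝ) (C : ℝ), S.Finite ∧ ∀ t ∈ Set.Ioo a b, t ∉ S →
      HasDerivAt v (deriv v t) t ∧ ‖deriv v t‖ ≤ C := by
  obtain ⟨hc, k, s, hs, h0, h1, hd⟩ := hv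
  have hb : ∀ i : Fin k, ∃ C : ℝ, ∀ t ∈ Set.Icc (s i.castSucc) (s i.succ),
      ‖derivWithin v (Set.Icc (s i.castSucc) (s i.succ)) t‖ ≤ C := by
    intro i
    refine isCompact_Icc.exists_bound_of_continuousOn ?_
    refine (hd i).continuousOn_derivWithin (uniqueDiffOn_Icc (hs (Fin.castSucc_lt_succ))) ?_
    norm_num
  choose C hC using hb
  refine ⟨Set.range s, ∑ i, |C i|, Set.finite_range s, fun t ht hts => ?_⟩
  obtain ⟨i, hi⟩ := part_mem s t (by rw [h0]; exact ht.1) (by rw [h1]; exact ht.2)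
    (fun j hj => hts ⟨j, hj⟩)
  have hn : Set.Icc (s i.castSucc) (s i.succ) ∈ 𝓝 t := Icc_mem_nhds hi.1 hi.2
  have hdiff : DifferentiableAt ℝ v t :=
    ((hd i).differentiableOn (by norm_num) t ⟨hi.1.le, hi.2.le⟩).differentiableAt hn
  refine ⟨hdiff.hasDerivAt, ?_⟩
  rw [← derivWithin_of_mem_nhds hn]
  refine (hC i t ⟨hi.1.le, hi.2.le⟩).trans ((le_abs_self _).trans ?_)
  exact Finset.single_le_sum (f := fun i => |C i|) (fun i _ => abs_nonneg _) (Finset.mem_univ i)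

def CRep (τ : ℝ) (v : ℝ → E) (f : Lp E 2 (mu τ)) : Prop :=
  (∀ᵐ t ∂(mu τ), HasDerivAt v (f t) t) ∧ ∀ t (ht : t ∈ Set.Icc 0 τ), v t = WL τ f ⟨t, ht⟩

lemma ae_mu (τ : ℝ) (S : Set ℝ) (hS : S.Finite) : ∀ᵐ t ∂(mu τ), t ∈ Set.Ioo 0 τ ∧ t ∉ S := by
  have h1 : ∀ᵐ t ∂(mu τ), t ∈ Set.Ioc 0 τ := ae_restrict_mem measurableSet_Ioc
  have h2 : ∀ᵐ t ∂(mu τ), t ∉ S ∪ {τ} :=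
    ae_restrict_of_ae ((hS.union (Set.finite_singleton τ)).countable.ae_notMem volume)
  filter_upwards [h1, h2] with t h1 h2
  rw [Set.mem_union, not_or] at h2
  exact ⟨⟨h1.1, lt_of_le_of_ne h1.2 h2.2⟩, h2.1⟩

lemma exists_rep (τ : ℝ) (hτ : 0 < τ) (v : ℝ → E) (hv : PiecewiseContDiffOn 2 v 0 τ)
    (hvτ : v τ = 0) : ∃ f, CRep τ v f := by
  borelize E
  obtain ⟨S, C, hS, hSC⟩ := pw_deriv v 0 τ hv
  have hae := ae_mu τ S hS
  have hm : MemLp (deriv v) 2 (mu τ) := by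
    refine MemLp.of_bound (aestronglyMeasurable_deriv v _) C ?_
    filter_upwards [hae] with t ht
    exact (hSC t ht.1 ht.2).2
  have hI : IntervalIntegrable (deriv v) volume 0 τ :=
    (intervalIntegrable_iff_integrableOn_Ioc_of_le hτ.le).2 (hm.integrable (by norm_num))
  refine ⟨hm.toLp _, ?_, ?_⟩
  · filter_upwards [hae, hm.coeFn_toLp] with t ht h2
    rw [h2]
    exact (hSC t ht.1 ht.2).1
  · intro t ht
    rw [WL_apply, Wf_congr τ _ _ hm.coeFn_toLp, Wf_eq τ _ t ht]
    rw [MeasureTheory.integral_eq_of_hasDerivAt_off_countable_of_le v (deriv v) ht.2 hS.countable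
      (hv.1.mono (Set.Icc_subset_Icc_left ht.1))
      (fun x hx => (hSC x ⟨ht.1.trans_lt hx.1.1, hx.1.2⟩ hx.2).1)
      (hI.mono_set (by rw [Set.uIcc_of_le ht.2, Set.uIcc_of_le hτ.le]; exact Set.Icc_subset_Icc_left ht.1)),
      hvτ, zero_sub, neg_neg]

lemma CRep.sum (τ : ℝ) {ι : Type*} (S : Finset ι) (v : ι → ℝ → E) (f : ι → Lp E 2 (mu τ))
    (h : ∀ i, CRep τ (v i) (f i)) (c : ι → ℝ) :
    CRep τ (fun t => ∑ i ∈ S, c i • v i t) (∑ i ∈ S, c i • f i) := by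
  classical
  induction S using Finset.induction_on with
  | empty =>
    refine ⟨?_, ?_⟩
    · filter_upwards [Lp.coeFn_zero E 2 (mu τ)] with t ht
      simp only [Finset.sum_empty]
      rw [ht]
      exact hasDerivAt_const t 0
    · intro t ht
      simp
  | insert i S hi ih =>
    simp only [Finset.sum_insert hi]
    refine ⟨?_, ?_⟩
    · filter_upwards [Lp.coeFn_add (c i • f i) (∑ i ∈ S, c i • f i), Lp.coeFn_smul (c i) (f i),
        ih.1, (h i).1] with t h1 h2 h3 h4
      rw [h1, Pi.add_apply, h2, Pi.smul_apply]
      exact (h4.const_smul (c i)).add h3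
    · intro t ht
      have := ih.2 t ht
      simp only at this ⊢
      rw [this, (h i).2 t ht, map_add, map_smul]
      rfl

lemma indexForm_eq (τ : ℝ) (hτ : 0 < τ) (R : ℝ → E →L[ℝ] E) (Q : E →ₗ[ℝ] E →ₗ[ℝ] ℝ)
    (R' : ℝ → E →L[ℝ] E) (hR' : Continuous R') (hRR : ∀ t ∈ Set.Icc 0 τ, R' t = R t)
    (v : ℝ → E) (f : Lp E 2 (mu τ)) (h : CRep τ v f) :
    indexForm R Q τ v = ⟪f, f⟫ - (Q (v 0) (v 0) +
      ∫ t in (0:ℝ)..τ, ⟪R' t (exF τ hτ (WL τ f) t), exF τ hτ (WL τ f) t⟫) := by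
  have h1 : ∫ t in (0:ℝ)..τ,
      (⟪derivWithin v (Set.Icc 0 τ) t, derivWithin v (Set.Icc 0 τ) t⟫ - ⟪R t (v t), v t⟫) =
      ∫ t, (⟪f t, f t⟫ - ⟪R' t (exF τ hτ (WL τ f) t), exF τ hτ (WL τ f) t⟫) ∂(mu τ) := by
    rw [← int_mu τ hτ]
    refine integral_congr_ae ?_
    filter_upwards [ae_mu τ ∅ Set.finite_empty, h.1] with t ht hd
    have hn : Set.Icc 0 τ ∈ 𝓝 t := Icc_mem_nhds ht.1.1 ht.1.2
    have hm : t ∈ Set.Icc 0 τ := ⟨ht.1.1.le, ht.1.2.le⟩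
    rw [derivWithin_of_mem_nhds hn, hd.deriv, hRR t hm, exF_of_mem τ hτ _ t hm, ← h.2 t hm]
  have hi : Integrable (fun t => ⟪R' t (exF τ hτ (WL τ f) t), exF τ hτ (WL τ f) t⟫) (mu τ) :=
    (intervalIntegrable_iff_integrableOn_Ioc_of_le hτ.le).1
      (((hR'.clm_apply (exF_cont τ hτ _)).inner (exF_cont τ hτ _)).intervalIntegrable _ _)
  rw [indexForm, h1, integral_sub (L2.integrable_inner f f) hi, ← L2.inner_def, ← int_mu τ hτ]
  ring

lemma eig_weak (τ : ℝ) (hτ : 0 < τ) (R : ℝ → E →L[ℝ] E) (Q : E →ₗ[ℝ] E →ₗ[ℝ] ℝ)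
    (E₀ : Submodule ℝ E)
    (R' : ℝ → E →L[ℝ] E) (hR' : Continuous R') (hRR : ∀ t ∈ Set.Icc 0 τ, R' t = R t)
    (u w : ℝ → E) (f g : Lp E 2 (mu τ)) (hf : CRep τ u f) (hg : CRep τ w g)
    (hu : ContDiffOn ℝ 2 u (Set.Icc 0 τ)) (hw : ContDiffOn ℝ 2 w (Set.Icc 0 τ))
    (hu0 : ∀ e ∈ E₀, ⟪derivWithin u (Set.Icc 0 τ) 0, e⟫ = -(Q (u 0) e))
    (hw0 : w 0 ∈ E₀) (hwτ : w τ = 0) (l : ℝ)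
    (heq : ∀ t ∈ Set.Icc 0 τ,
      derivWithin (derivWithin u (Set.Icc 0 τ)) (Set.Icc 0 τ) t + R t (u t) = l • u t) :
    ⟪f, g⟫ - (Q (u 0) (w 0) +
      ∫ t in (0:ℝ)..τ, ⟪R' t (exF τ hτ (WL τ f) t), exF τ hτ (WL τ g) t⟫) +
      l * (∫ t in (0:ℝ)..τ, ⟪exF τ hτ (WL τ f) t, exF τ hτ (WL τ g) t⟫) = 0 := by
  set I := Set.Icc 0 τ with hI
  have hU : UniqueDiffOn ℝ I := uniqueDiffOn_Icc hτ
  have hu1 : ContDiffOn ℝ 1 (derivWithin u I) I := hu.derivWithin hU (by norm_num)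
  have hu2c : ContinuousOn (derivWithin (derivWithin u I) I) I :=
    hu1.continuousOn_derivWithin hU le_rfl
  have hw1c : ContinuousOn (derivWithin w I) I := hw.continuousOn_derivWithin hU (by norm_num)
  have dA : ∀ z : ℝ → E, DifferentiableOn ℝ z I → ∀ t ∈ Set.Ioo 0 τ,
      HasDerivAt z (derivWithin z I t) t := fun z hz t ht =>
    (hz t ⟨ht.1.le, ht.2.le⟩).hasDerivWithinAt.hasDerivAt (Icc_mem_nhds ht.1 ht.2)
  have du := dA u (hu.differentiableOn (by norm_num))
  have dw := dA w (hw.differentiableOn (by norm_num))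
  have du1 := dA _ (hu1.differentiableOn (by norm_num))
  have c1 : ContinuousOn (fun t => ⟪derivWithin u I t, derivWithin w I t⟫) I :=
    hu1.continuousOn.inner hw1c
  have c2 : ContinuousOn (fun t => ⟪derivWithin (derivWithin u I) I t, w t⟫) I :=
    hu2c.inner hw.continuousOn
  have i1 : IntervalIntegrable (fun t => ⟪derivWithin u I t, derivWithin w I t⟫) volume 0 τ :=
    c1.intervalIntegrable_of_Icc hτ.le
  have i2 : IntervalIntegrable (fun t => ⟪derivWithin (derivWithin u I) I t, w t⟫) volume 0 τ :=
    c2.intervalIntegrable_of_Icc hτ.le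
  have ftc := intervalIntegral.integral_eq_sub_of_hasDerivAt_of_le hτ.le
    (hu1.continuousOn.inner hw.continuousOn) (fun t ht => (du1 t ht).inner ℝ (dw t ht)) (i1.add i2)
  rw [intervalIntegral.integral_add i1 i2, hwτ, inner_zero_right, hu0 _ hw0] at ftc
  have e1 : ⟪f, g⟫ = ∫ t in (0:ℝ)..τ, ⟪derivWithin u I t, derivWithin w I t⟫ := by
    rw [L2.inner_def, ← int_mu τ hτ]
    refine integral_congr_ae ?_
    filter_upwards [ae_mu τ ∅ Set.finite_empty, hf.1, hg.1] with t ht h1 h2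
    rw [(du t ht.1).unique h1, (dw t ht.1).unique h2]
  have i3 : IntervalIntegrable (fun t => ⟪exF τ hτ (WL τ f) t, exF τ hτ (WL τ g) t⟫) volume 0 τ :=
    ((exF_cont τ hτ _).inner (exF_cont τ hτ _)).intervalIntegrable _ _
  have i4 : IntervalIntegrable (fun t => ⟪R' t (exF τ hτ (WL τ f) t), exF τ hτ (WL τ g) t⟫)
      volume 0 τ :=
    ((hR'.clm_apply (exF_cont τ hτ _)).inner (exF_cont τ hτ _)).intervalIntegrable _ _
  have e2 : ∫ t in (0:ℝ)..τ, ⟪derivWithin (derivWithin u I) I t, w t⟫ =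
      l * (∫ t in (0:ℝ)..τ, ⟪exF τ hτ (WL τ f) t, exF τ hτ (WL τ g) t⟫) -
      ∫ t in (0:ℝ)..τ, ⟪R' t (exF τ hτ (WL τ f) t), exF τ hτ (WL τ g) t⟫ := by
    rw [← intervalIntegral.integral_const_mul, ← intervalIntegral.integral_sub (i3.const_mul l) i4]
    refine intervalIntegral.integral_congr fun t ht => ?_
    rw [Set.uIcc_of_le hτ.le] at ht
    rw [exF_of_mem τ hτ _ t ht, exF_of_mem τ hτ _ t ht, ← hf.2 t ht, ← hg.2 t ht, hRR t ht,
      eq_sub_of_add_eq (heq t ht), inner_sub_left, inner_smul_left]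
    simp
  rw [e1]
  linarith
end conc3

section conc4
open Filter Topology MeasureTheory
set_option linter.unusedSectionVars false
variable {E : Type*} [NormedAddCommGroup E] [InnerProductSpace ℝ E] [FiniteDimensional ℝ E]

lemma eig_of_weak (τ : ℝ) (hτ : 0 < τ) (R : ℝ → E →L[ℝ] E) (Q Q' : E →ₗ[ℝ] E →ₗ[ℝ] ℝ)
    (E₀ : Submodule ℝ E) (hQ : ∀ x ∈ E₀, ∀ y ∈ E₀, Q' x y = Q x y)
    (R' : ℝ → E →L[ℝ] E) (hR' : Continuous R') (hRR : ∀ t ∈ Set.Icc 0 τ, R' t = R t)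
    (f : Lp E 2 (mu τ)) (hf : exF τ hτ (WL τ f) 0 ∈ E₀) (l : ℝ) (hl : 0 < l)
    (hw : ∀ h : Lp E 2 (mu τ), exF τ hτ (WL τ h) 0 ∈ E₀ →
      ⟪f, h⟫ - (Q' (exF τ hτ (WL τ f) 0) (exF τ hτ (WL τ h) 0) +
      ∫ t in (0:ℝ)..τ, ⟪R' t (exF τ hτ (WL τ f) t), exF τ hτ (WL τ h) t⟫) +
      l * (∫ t in (0:ℝ)..τ, ⟪exF τ hτ (WL τ f) t, exF τ hτ (WL τ h) t⟫) = 0) :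
    ∃ u : ℝ → E, IsPositiveEigenfunction R E₀ Q τ u ∧
      ∀ t (ht : t ∈ Set.Icc 0 τ), u t = WL τ f ⟨t, ht⟩ := by
  have z0 : (0:ℝ) ∈ Set.Icc 0 τ := ⟨le_rfl, hτ.le⟩
  have zτ : τ ∈ Set.Icc 0 τ := ⟨hτ.le, le_rfl⟩
  let p : E := (InnerProductSpace.toDual ℝ E).symm
    (LinearMap.toContinuousLinearMap (Q' (exF τ hτ (WL τ f) 0)))
  have hp : ∀ y, ⟪p, y⟫ = Q' (exF τ hτ (WL τ f) 0) y := fun y => by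
    simp [p, InnerProductSpace.toDual_symm_apply]
  let A : ℝ → E →L[ℝ] E := fun t => R' t - l • ContinuousLinearMap.id ℝ E
  have hA : Continuous A := hR'.sub continuous_const
  obtain ⟨u, u', h1, h2, h3, h4⟩ := regularity τ hτ E₀ A hA p f (by
    intro h hh
    have e0 : ∫ t, h t ∂(mu τ) = - exF τ hτ (WL τ h) 0 := by
      rw [Wf_zero τ hτ, exF_WL τ hτ h 0 z0]
    rw [e0] at hh
    have := hw h (by simpa using E₀.neg_mem hh)
    rw [e0, inner_neg_right, hp]
    have i3 : IntervalIntegrable (fun t => ⟪exF τ hτ (WL τ f) t, exF τ hτ (WL τ h) t⟫) volume 0 τ :=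
      ((exF_cont τ hτ _).inner (exF_cont τ hτ _)).intervalIntegrable _ _
    have i4 : IntervalIntegrable (fun t => ⟪R' t (exF τ hτ (WL τ f) t), exF τ hτ (WL τ h) t⟫)
        volume 0 τ :=
      ((hR'.clm_apply (exF_cont τ hτ _)).inner (exF_cont τ hτ _)).intervalIntegrable _ _
    have e2 : ∫ t in (0:ℝ)..τ, ⟪A t (exF τ hτ (WL τ f) t), exF τ hτ (WL τ h) t⟫ =
        (∫ t in (0:ℝ)..τ, ⟪R' t (exF τ hτ (WL τ f) t), exF τ hτ (WL τ h) t⟫) -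
        l * (∫ t in (0:ℝ)..τ, ⟪exF τ hτ (WL τ f) t, exF τ hτ (WL τ h) t⟫) := by
      rw [← intervalIntegral.integral_const_mul,
        ← intervalIntegral.integral_sub i4 (i3.const_mul l)]
      refine intervalIntegral.integral_congr fun t ht => ?_
      simp [A, inner_sub_left, inner_smul_left]
    rw [e2]
    linarith)
  have huW : ∀ t (ht : t ∈ Set.Icc 0 τ), u t = WL τ f ⟨t, ht⟩ := fun t ht => h3 t ht
  have hux : ∀ t (ht : t ∈ Set.Icc 0 τ), u t = exF τ hτ (WL τ f) t := fun t ht => by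
    rw [exF_of_mem τ hτ _ t ht, huW t ht]
  have hU : UniqueDiffOn ℝ (Set.Icc 0 τ) := uniqueDiffOn_Icc hτ
  have d1 : ∀ t ∈ Set.Icc 0 τ, derivWithin u (Set.Icc 0 τ) t = u' t := fun t ht =>
    (h1 t).hasDerivWithinAt.derivWithin (hU t ht)
  have d2 : ∀ t ∈ Set.Icc 0 τ, derivWithin (derivWithin u (Set.Icc 0 τ)) (Set.Icc 0 τ) t =
      -(A t (exF τ hτ (WL τ f) t)) := fun t ht => by
    rw [derivWithin_congr d1 (d1 t ht)]
    exact (h2 t).hasDerivWithinAt.derivWithin (hU t ht)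
  have du : deriv u = u' := funext fun t => (h1 t).deriv
  have du' : deriv u' = fun t => -(A t (exF τ hτ (WL τ f) t)) := funext fun t => (h2 t).deriv
  have c1 : ContDiff ℝ 1 u' := by
    rw [contDiff_one_iff_deriv]
    refine ⟨fun t => (h2 t).differentiableAt, ?_⟩
    rw [du']
    exact (hA.clm_apply (exF_cont τ hτ _)).neg
  have c2 : ContDiff ℝ 2 u := by
    rw [show (2 : WithTop ℕ∞) = 1 + 1 by norm_num, contDiff_succ_iff_deriv]
    refine ⟨fun t => (h1 t).differentiableAt, by simp, ?_⟩
    rw [du]; exact c1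
  have hu0 : u 0 ∈ E₀ := by rw [hux 0 z0]; exact hf
  refine ⟨u, ⟨⟨⟨c2.continuous.continuousOn, 1, ![0, τ], ?_, rfl, rfl, ?_⟩, hu0, ?_, ?_⟩,
    c2.contDiffOn, l, hl, ?_⟩, huW⟩
  · rw [Fin.strictMono_iff_lt_succ]
    intro i
    fin_cases i
    simpa using hτ
  · intro i
    exact c2.contDiffOn
  · intro e he
    have := h4 e he
    rw [inner_add_left, hp, ← hux 0 z0, hQ _ hu0 _ he] at this
    rw [d1 0 z0]
    linarith
  · rw [h3 τ zτ, Wf_tau]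
  · intro t ht
    rw [d2 t ht, hux t ht, ← hRR t ht]
    simp [A]

end conc4

open MeasureTheory in
/-- **(Hermann.)** The Morse index of the index form `I` on `Ω([0,τ],E)` equals the
maximal number of linearly independent `C²` elements of `Ω([0,τ],E)` which are
eigenfunctions of `J = d²/dt² + R_t` for positive eigenvalues. -/
theorem morse_index_eq_sup_positive_eigenfunctions
    {E : Type*} [NormedAddCommGroup E] [InnerProductSpace ℝ E] [FiniteDimensional ℝ E]
    (τ : ℝ) (hτ : 0 < τ)
    (R : ℝ → E →L[ℝ] E) (hRcont : ContinuousOn R (Set.Icc 0 τ))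
    (hRsa : ∀ t ∈ Set.Icc (0:ℝ) τ, ∀ u v : E, ⟪R t u, v⟫ = ⟪u, R t v⟫)
    (E₀ : Submodule ℝ E) (Q : E →ₗ[ℝ] E →ₗ[ℝ] ℝ)
    (hQsymm : ∀ x ∈ E₀, ∀ y ∈ E₀, Q x y = Q y x) :
    BddAbove (MorseIndexSet R E₀ Q τ) ∧
    BddAbove {n : ℕ | ∃ u : Fin n → ℝ → E,
      (∀ i, IsPositiveEigenfunction R E₀ Q τ (u i)) ∧
      ∀ c : Fin n → ℝ, (∀ t ∈ Set.Icc 0 τ, (∑ i, c i • u i t) = 0) → c = 0} ∧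
    sSup (MorseIndexSet R E₀ Q τ) =
      sSup {n : ℕ | ∃ u : Fin n → ℝ → E,
        (∀ i, IsPositiveEigenfunction R E₀ Q τ (u i)) ∧
        ∀ c : Fin n → ℝ, (∀ t ∈ Set.Icc 0 τ, (∑ i, c i • u i t) = 0) → c = 0} := by
  have z0 : (0:ℝ) ∈ Set.Icc 0 τ := ⟨le_rfl, hτ.le⟩
  let R' : ℝ → E →L[ℝ] E := fun t => R (Set.projIcc 0 τ hτ.le t)
  have hR' : Continuous R' := hRcont.domRestrict.comp continuous_projIcc
  have hRR : ∀ t ∈ Set.Icc 0 τ, R' t = R t := fun t ht => by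
    simp only [R']; rw [Set.projIcc_of_mem hτ.le ht]
  let P : E →ₗ[ℝ] E := (E₀.starProjection : E →L[ℝ] E).toLinearMap
  have hPm : ∀ x, P x ∈ E₀ := fun x => E₀.starProjection_apply_mem x
  have hPe : ∀ x ∈ E₀, P x = x := fun x hx => Submodule.starProjection_eq_self_iff.2 hx
  let Q' : E →ₗ[ℝ] E →ₗ[ℝ] ℝ := Q.compl₁₂ P P
  have hQ' : ∀ x ∈ E₀, ∀ y ∈ E₀, Q' x y = Q x y := fun x hx y hy => by
    simp only [Q', LinearMap.compl₁₂_apply, hPe x hx, hPe y hy]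
  have hQs : ∀ x y, Q' x y = Q' y x := fun x y => hQsymm _ (hPm x) _ (hPm y)
  obtain ⟨k, hk⟩ := exists_form τ hτ R' hR' Q'
  obtain ⟨s, hs⟩ := exists_form (E := E) τ hτ (fun _ => ContinuousLinearMap.id ℝ E) continuous_const 0
  replace hs : ∀ u w, s u w = ∫ t in (0:ℝ)..τ, ⟪exF τ hτ u t, exF τ hτ w t⟫ := fun u w => by
    rw [hs]; simp
  have hks : ∀ x y, k x y = k y x := fun x y => by
    rw [hk, hk, hQs]
    congr 1
    refine intervalIntegral.integral_congr fun t ht => ?_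
    rw [Set.uIcc_of_le hτ.le] at ht
    simp only [hRR t ht]
    rw [hRsa t ht, real_inner_comm]
  have hss : ∀ x y, s x y = s y x := fun x y => by
    rw [hs, hs]
    refine intervalIntegral.integral_congr fun t ht => ?_
    exact real_inner_comm _ _
  have hspos : ∀ x, x ≠ 0 → 0 < s x x := fun x hx => by rw [hs]; exact l2_pos τ hτ x hx
  let ev : BoundedContinuousFunction (Set.Icc 0 τ) E →L[ℝ] E :=
    BoundedContinuousFunction.evalCLM ℝ (⟨0, z0⟩ : Set.Icc 0 τ)
  let H0 : Submodule ℝ (Lp E 2 (mu τ)) := E₀.comap (ev.comp (WL τ)).toLinearMap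
  have hH0 : ∀ f : Lp E 2 (mu τ), f ∈ H0 ↔ exF τ hτ (WL τ f) 0 ∈ E₀ := fun f => by
    rw [exF_of_mem τ hτ _ 0 z0]; rfl
  have hcl : IsClosed (H0 : Set (Lp E 2 (mu τ))) :=
    E₀.closed_of_finiteDimensional.preimage (ev.comp (WL τ)).continuous
  have : CompleteSpace H0 := hcl.completeSpace_coe
  let W : H0 →L[ℝ] BoundedContinuousFunction (Set.Icc 0 τ) E := (WL τ).comp H0.subtypeL
  obtain ⟨K, hK, hKW⟩ := WL_cpt (E := E) τ
  have hWK : ∀ x, ‖x‖ ≤ 1 → W x ∈ K := fun x hx => hKW x hx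
  have hWc : SeqCpt W := by
    intro x hx
    obtain ⟨y, -, φ, hφ, hy⟩ := hK.tendsto_subseq (fun n => hWK (x n) (hx n))
    exact ⟨φ, hφ, y, hy⟩
  obtain ⟨N, hN⟩ := neg_bdd W K hK hWK k s
  -- representation of families
  have hrep : ∀ (n : ℕ) (v : Fin n → ℝ → E), (∀ i, InOmega E₀ Q τ (v i)) →
      ∃ f : Fin n → H0, (∀ i, CRep τ (v i) (f i)) ∧ (∀ c : Fin n → ℝ,
        indexForm R Q τ (fun t => ∑ i, c i • v i t) =
          PF W k s 0 (∑ i, c i • f i) (∑ i, c i • f i)) := by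
    intro n v hv
    have : ∀ i, ∃ f : H0, CRep τ (v i) f := by
      intro i
      obtain ⟨f, hf⟩ := exists_rep τ hτ (v i) (hv i).1 (hv i).2.2.2
      refine ⟨⟨f, (hH0 f).2 ?_⟩, hf⟩
      rw [exF_of_mem τ hτ _ 0 z0, ← hf.2 0 z0]
      exact (hv i).2.1
    choose f hf using this
    refine ⟨f, hf, fun c => ?_⟩
    have hr := CRep.sum τ Finset.univ v (fun i => (f i : Lp E 2 (mu τ))) hf c
    have hco : ((∑ i, c i • f i : H0) : Lp E 2 (mu τ)) = ∑ i, c i • (f i : Lp E 2 (mu τ)) := by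
      simp
    rw [← hco] at hr
    generalize (∑ i, c i • f i : H0) = g at hr
    rw [indexForm_eq τ hτ R Q R' hR' hRR _ _ hr, PF_apply, zero_mul, add_zero, hk]
    have h0 : exF τ hτ (WL τ g) 0 ∈ E₀ := (hH0 g).1 g.2
    change _ = ⟪(g : Lp E 2 (mu τ)), g⟫ - (Q' (exF τ hτ (WL τ g) 0) (exF τ hτ (WL τ g) 0) + _)
    rw [hQ' _ h0 _ h0]
    have h00 : exF τ hτ (WL τ (g : Lp E 2 (mu τ))) 0 = ∑ i, c i • v i 0 := by
      rw [exF_of_mem τ hτ _ 0 z0]; exact (hr.2 0 z0).symm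
    rw [h00]
    rfl
  have hcomb : ∀ (n : ℕ) (u : Fin n → ℝ → E) (f : Fin n → H0),
      (∀ i t (ht : t ∈ Set.Icc 0 τ), u i t = WL τ (f i) ⟨t, ht⟩) → ∀ c : Fin n → ℝ,
      (∀ t ∈ Set.Icc 0 τ, ∑ i, c i • u i t = 0) ↔ ∑ i, c i • W (f i) = 0 := by
    intro n u f hu c
    have e : ∀ t (ht : t ∈ Set.Icc 0 τ), ∑ i, c i • u i t = (∑ i, c i • W (f i)) ⟨t, ht⟩ := by
      intro t ht
      rw [BoundedContinuousFunction.coe_sum, Finset.sum_apply]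
      refine Finset.sum_congr rfl fun i _ => ?_
      rw [hu i t ht]; rfl
    constructor
    · intro h
      ext t
      rw [← e t.1 t.2, h t.1 t.2]; rfl
    · intro h t ht
      rw [e t ht, h]; rfl
  set B := {n : ℕ | ∃ u : Fin n → ℝ → E,
        (∀ i, IsPositiveEigenfunction R E₀ Q τ (u i)) ∧
        ∀ c : Fin n → ℝ, (∀ t ∈ Set.Icc 0 τ, (∑ i, c i • u i t) = 0) → c = 0} with hB
  have hbdd : BddAbove (MorseIndexSet R E₀ Q τ) := by
    refine ⟨N, ?_⟩
    rintro n ⟨v, hv, -, hneg⟩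
    obtain ⟨f, hf, hI⟩ := hrep n v hv
    exact hN n f (fun c hc => by rw [← hI]; exact hneg c hc)
  have hAB : MorseIndexSet R E₀ Q τ = B := by
    apply Set.Subset.antisymm
    · rintro n ⟨v, hv, -, hneg⟩
      obtain ⟨f, hf, hI⟩ := hrep n v hv
      obtain ⟨x, hx0, hxo, hxe⟩ := exists_family W hWc k s hks hss hspos n f
        (fun c hc => by rw [← hI]; exact hneg c hc) n le_rfl
      have : ∀ i, ∃ u : ℝ → E, IsPositiveEigenfunction R E₀ Q τ u ∧
          ∀ t (ht : t ∈ Set.Icc 0 τ), u t = WL τ (x i) ⟨t, ht⟩ := by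
        intro i
        obtain ⟨l, hl, hxl⟩ := hxe i
        refine eig_of_weak τ hτ R Q Q' E₀ hQ' R' hR' hRR (x i) ((hH0 _).1 (x i).2) l hl ?_
        intro h hh
        have := hxl ⟨h, (hH0 h).2 hh⟩
        rw [PF_apply, hk, hs] at this
        exact this
      choose u hu huW using this
      refine ⟨u, hu, fun c hc => ?_⟩
      exact indep_of_orth W s hspos n x hx0 hxo c ((hcomb n u x huW c).1 hc)
    · rintro n ⟨u, hu, hind⟩
      obtain ⟨f, hf, hI⟩ := hrep n u (fun i => (hu i).1)
      choose l hl hleq using fun i => (hu i).2.2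
      refine ⟨u, fun i => (hu i).1, hind, fun c hc => ?_⟩
      rw [hI]
      refine neg_of_eig W k s hks hss hspos n f l hl ?_ ?_ c hc
      · intro i j
        have := eig_weak τ hτ R Q E₀ R' hR' hRR (u i) (u j) (f i) (f j) (hf i) (hf j)
          (hu i).2.1 (hu j).2.1 (hu i).1.2.2.1 (hu j).1.2.1 (hu j).1.2.2.2 (l i) (hleq i)
        rw [PF_apply, hk, hs]
        have e : ∀ i, exF τ hτ (WL τ (f i : Lp E 2 (mu τ))) 0 = u i 0 := fun i => by
          rw [exF_of_mem τ hτ _ 0 z0]; exact ((hf i).2 0 z0).symm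
        change ⟪(f i : Lp E 2 (mu τ)), f j⟫ - (Q' (exF τ hτ (WL τ (f i : Lp E 2 (mu τ))) 0)
          (exF τ hτ (WL τ (f j : Lp E 2 (mu τ))) 0) + _) + _ = 0
        rw [e, e, hQ' _ (hu i).1.2.1 _ (hu j).1.2.1]
        exact this
      · intro c hc
        exact hind c ((hcomb n u f (fun i => (hf i).2) c).2 hc)
  exact ⟨hbdd, hAB ▸ hbdd, by rw [hAB]⟩
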